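/- Fix an integer k ≥ 2 and let n = kr with r → ∞; let λ = k − 1. Let a = a(n) be a sequence of positive reals with a^{−1}·log^{−1/3} n = o(1), and set ξ = (E_n^{{0,k}}(T))^a. Then for all sufficiently large r, the uniform probability over {0,k}-mappings f on [n] satisfies P_n^{{0,k}}(T ≥ ξ) < exp(−λ·n^{1/3}/(3·log⁶ n)). Consequently the expected number of independent uniform samples needed to find a mapping f with T(f) ≥ ξ, which equals 1/P_n^{{0,k}}(T ≥ ξ), exceeds exp(λ·n^{1/3}/(3·log⁶ n)), and exp(λ·n^{1/3}/(4·log⁶ n))·P_n^{{0,k}}(T ≥ ξ) ≤ exp(−λ·n^{1/3}/(12·log⁶ n)). -/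

import Mathlib

open Filter Finset Asymptotics MeasureTheory

noncomputable section

open scoped Classical

/-- `f` is a `{0,k}`-mapping: every point has either `0` or `k` preimages. -/
def IsZKMap {n : ℕ} (k : ℕ) (f : Fin n → Fin n) : Prop :=
  ∀ y : Fin n,
    (Finset.univ.filter fun x => f x = y).card = 0 ∨
    (Finset.univ.filter fun x => f x = y).card = k

/-- The finite set of `{0,k}`-mappings on `[n]`. -/
def zkMaps (n k : ℕ) : Finset (Fin n → Fin n) :=
  Finset.univ.filter fun f => IsZKMap k f

/-- The set of cyclic nodes of `f`. -/
def cyclicSet {n : ℕ} (f : Fin n → Fin n) : Finset (Fin n) :=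
  Finset.univ.filter fun x => ∃ m, 0 < m ∧ f^[m] x = x

/-- `Z f`: the number of cyclic nodes of `f`. -/
def Zmap {n : ℕ} (f : Fin n → Fin n) : ℕ := (cyclicSet f).card

/-- The cycles of `f`: the orbits of the cyclic nodes under `f`. -/
def cyclesOf {n : ℕ} (f : Fin n → Fin n) : Finset (Finset (Fin n)) :=
  (cyclicSet f).image fun x => (cyclicSet f).filter fun y => ∃ m, f^[m] x = y

/-- `T f`: the least common multiple of the cycle lengths of `f`. -/
def Tmap {n : ℕ} (f : Fin n → Fin n) : ℕ := (cyclesOf f).lcm Finset.card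

/-- `B f`: the product of the cycle lengths of `f`, counted with multiplicity. -/
def Bmap {n : ℕ} (f : Fin n → Fin n) : ℕ := ∏ c ∈ cyclesOf f, c.card

/-- `C f`: the number of cycles of `f`. -/
def Cmap {n : ℕ} (f : Fin n → Fin n) : ℕ := (cyclesOf f).card

/-- Uniform probability of the event `p` over `{0,k}`-mappings on `[n]`. -/
def zkProb (n k : ℕ) (p : (Fin n → Fin n) → Prop) : ℝ :=
  (((zkMaps n k).filter p).card : ℝ) / ((zkMaps n k).card : ℝ)

/-- Expectation of `X` under the uniform measure on `{0,k}`-mappings on `[n]`. -/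
def zkExp (n k : ℕ) (X : (Fin n → Fin n) → ℝ) : ℝ :=
  (∑ f ∈ zkMaps n k, X f) / ((zkMaps n k).card : ℝ)

/-- The standard normal cumulative distribution function. -/
def stdNormalCDF (x : ℝ) : ℝ :=
  (Real.sqrt (2 * Real.pi))⁻¹ * ∫ t in Set.Iic x, Real.exp (-t ^ 2 / 2)

/-- `M m`: the average order of a uniformly random permutation of `[m]`. -/
def Mperm (m : ℕ) : ℝ :=
  (∑ σ : Equiv.Perm (Fin m), (orderOf σ : ℝ)) / (m.factorial : ℝ)

section CyclicStructure

variable {n : ℕ} {f : Fin n → Fin n}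

lemma mem_cyclicSet_iff {x : Fin n} : x ∈ cyclicSet f ↔ x ∈ Function.periodicPts f := by
  simp [cyclicSet, Function.periodicPts, Function.IsPeriodicPt, Function.IsFixedPt]

/-- The restriction of `f` to its cyclic nodes, as a permutation. -/
def cyclicPerm (f : Fin n → Fin n) : Equiv.Perm (cyclicSet f) :=
  Equiv.ofBijective
    (fun a => ⟨f a, mem_cyclicSet_iff.2
      ((Function.bijOn_periodicPts f).mapsTo (mem_cyclicSet_iff.1 a.2))⟩)
    (Finite.injective_iff_bijective.1 fun a b hab => Subtype.ext
      ((Function.bijOn_periodicPts f).injOn (mem_cyclicSet_iff.1 a.2)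
        (mem_cyclicSet_iff.1 b.2) (congrArg Subtype.val hab)))

lemma coe_cyclicPerm (a : cyclicSet f) : (cyclicPerm f a : Fin n) = f a := rfl

lemma comp_ofSubtype_apply (τ : Equiv.Perm (cyclicSet f)) (a : cyclicSet f) :
    (f ∘ Equiv.Perm.ofSubtype τ) a = ((cyclicPerm f * τ) a : Fin n) := by
  simp [coe_cyclicPerm]

lemma iterate_eq_coe_pow {g : Fin n → Fin n} {A : Finset (Fin n)} {σ : Equiv.Perm A}
    (h : ∀ a : A, g a = σ a) (m : ℕ) (a : A) : g^[m] a = ((σ ^ m) a : Fin n) := by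
  induction m with
  | zero => simp
  | succ m ih => rw [Function.iterate_succ_apply', ih, h, pow_succ']; rfl

lemma cyclicSet_comp_ofSubtype (τ : Equiv.Perm (cyclicSet f)) :
    cyclicSet (f ∘ Equiv.Perm.ofSubtype τ) = cyclicSet f := by
  set g := f ∘ Equiv.Perm.ofSubtype τ with hg
  have hit := iterate_eq_coe_pow (g := g) (comp_ofSubtype_apply τ)
  ext x
  constructor
  · intro hx
    by_contra hxA
    obtain ⟨m, hm, hmx⟩ := (Finset.mem_filter.1 hx).2
    have havoid : ∀ i, g^[i] x ∉ cyclicSet f := by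
      intro i hi
      apply hxA
      have h1 : g^[m * i] x = x := by
        rw [Function.iterate_mul]
        exact Function.iterate_fixed hmx i
      have h2 := hit (m * i - i) ⟨_, hi⟩
      have h3 : m * i - i + i = m * i := Nat.sub_add_cancel (Nat.le_mul_of_pos_left i hm)
      rw [← Function.iterate_add_apply, h3, h1] at h2
      rw [h2]
      exact Subtype.property _
    have heq : ∀ i, g^[i] x = f^[i] x := by
      intro i
      induction i with
      | zero => rfl
      | succ i ih =>
        rw [Function.iterate_succ_apply', Function.iterate_succ_apply', ← ih, hg,
          Function.comp_apply, Equiv.Perm.ofSubtype_apply_of_not_mem _ (havoid i)]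
    exact hxA (Finset.mem_filter.2 ⟨Finset.mem_univ _, m, hm, by rw [← heq, hmx]⟩)
  · intro hx
    refine Finset.mem_filter.2 ⟨Finset.mem_univ _, orderOf (cyclicPerm f * τ), orderOf_pos _, ?_⟩
    have := hit (orderOf (cyclicPerm f * τ)) ⟨x, hx⟩
    rw [pow_orderOf_eq_one] at this
    exact this

end CyclicStructure

section Averaging

variable {n k : ℕ}

lemma mem_zkMaps {f : Fin n → Fin n} : f ∈ zkMaps n k ↔ IsZKMap k f := by
  simp [zkMaps]

lemma IsZKMap.comp_perm {f : Fin n → Fin n} (hf : IsZKMap k f) (π ρ : Equiv.Perm (Fin n)) :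
    IsZKMap k (ρ ∘ f ∘ π) := by
  intro y
  have : (Finset.univ.filter fun x => (ρ ∘ f ∘ π) x = y).card
      = (Finset.univ.filter fun x => f x = ρ.symm y).card := by
    refine Finset.card_equiv π fun x => ?_
    simp [Equiv.eq_symm_apply]
  rw [this]
  exact hf _

/-- The `{0,k}`-mappings with prescribed set of cyclic nodes. -/
def zkMapsOn (k : ℕ) (A : Finset (Fin n)) : Finset (Fin n → Fin n) :=
  (zkMaps n k).filter fun f => cyclicSet f = A

lemma comp_ofSubtype_mem_zkMapsOn {A : Finset (Fin n)} {f : Fin n → Fin n}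
    (hf : f ∈ zkMapsOn k A) (τ : Equiv.Perm A) :
    f ∘ Equiv.Perm.ofSubtype τ ∈ zkMapsOn k A := by
  obtain ⟨hmap, rfl⟩ := Finset.mem_filter.1 hf
  refine Finset.mem_filter.2 ⟨mem_zkMaps.2 ?_, cyclicSet_comp_ofSubtype τ⟩
  exact (mem_zkMaps.1 hmap).comp_perm (Equiv.Perm.ofSubtype τ) 1

lemma sum_zkMapsOn_comp_perm (A : Finset (Fin n)) (G : (Fin n → Fin n) → ℝ) :
    ∑ f ∈ zkMapsOn k A, ∑ τ : Equiv.Perm A, G (f ∘ Equiv.Perm.ofSubtype τ)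
      = (A.card.factorial : ℝ) * ∑ f ∈ zkMapsOn k A, G f := by
  rw [Finset.sum_comm]
  have h : ∀ τ : Equiv.Perm A, ∑ f ∈ zkMapsOn k A, G (f ∘ Equiv.Perm.ofSubtype τ)
      = ∑ f ∈ zkMapsOn k A, G f := by
    intro τ
    refine Finset.sum_nbij' (fun f => f ∘ Equiv.Perm.ofSubtype τ)
      (fun f => f ∘ Equiv.Perm.ofSubtype τ⁻¹)
      (fun f hf => comp_ofSubtype_mem_zkMapsOn hf τ)
      (fun f hf => comp_ofSubtype_mem_zkMapsOn hf τ⁻¹) ?_ ?_ (fun _ _ => rfl)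
    · intro f _
      ext x
      simp
    · intro f _
      ext x
      simp
  rw [Finset.sum_congr rfl fun τ _ => h τ]
  simp [Fintype.card_perm]

lemma sum_zkMaps_eq_sum_zkMapsOn (G : (Fin n → Fin n) → ℝ) :
    ∑ f ∈ zkMaps n k, G f = ∑ A : Finset (Fin n), ∑ f ∈ zkMapsOn k A, G f :=
  (Finset.sum_fiberwise _ _ _).symm

end Averaging

section CyclicTail

/-- The number of `z`-tuples of distinct fixed points of `f`. -/
def fixedTuples {α : Type*} [Fintype α] (z : ℕ) (f : α → α) : ℕ :=
  (Finset.univ.filter fun x : Fin z ↪ α => ∀ i, f (x i) = x i).card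

lemma card_perm_fixing_embedding {α : Type*} [Fintype α] [DecidableEq α] {z : ℕ} (x : Fin z ↪ α) :
    (Finset.univ.filter fun σ : Equiv.Perm α => ∀ i, σ (x i) = x i).card
      = (Fintype.card α - z).factorial := by
  have e := Equiv.Perm.subtypeEquivSubtypePerm (fun a => a ∉ Set.range x)
  have h1 : Fintype.card {a // a ∉ Set.range x} = Fintype.card α - z := by
    rw [Fintype.card_subtype_compl]
    congr 1
    exact (Fintype.card_congr (Equiv.ofInjective x x.injective)).symm.trans (Fintype.card_fin z)
  rw [← h1, ← Fintype.card_perm, Fintype.card_congr e, Fintype.card_subtype]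
  congr 1
  ext σ
  simp

lemma sum_fixedTuples_perm {α : Type*} [Fintype α] [DecidableEq α] (z : ℕ) :
    ∑ σ : Equiv.Perm α, fixedTuples z σ
      = if z ≤ Fintype.card α then (Fintype.card α).factorial else 0 := by
  have h : ∑ σ : Equiv.Perm α, fixedTuples z σ
      = ∑ x : Fin z ↪ α,
        (Finset.univ.filter fun σ : Equiv.Perm α => ∀ i, σ (x i) = x i).card := by
    simp only [fixedTuples, Finset.card_filter]
    rw [Finset.sum_comm]
    congr!
  rw [h, Finset.sum_congr rfl fun x _ => card_perm_fixing_embedding x, Finset.sum_const,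
    Finset.card_univ, Fintype.card_embedding_eq, Fintype.card_fin, smul_eq_mul]
  split_ifs with hz
  · rw [mul_comm, Nat.factorial_mul_descFactorial hz]
  · rw [Nat.descFactorial_eq_zero_iff_lt.2 (by omega), zero_mul]

variable {n k : ℕ}

lemma fixedTuples_eq_of_cyclicSet {g : Fin n → Fin n} {A : Finset (Fin n)}
    (hA : cyclicSet g = A) {σ : Equiv.Perm A} (h : ∀ a : A, g a = σ a) (z : ℕ) :
    fixedTuples z g = fixedTuples z σ := by
  have hmem : ∀ x, g x = x → x ∈ A := fun x hx => by
    rw [← hA]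
    exact Finset.mem_filter.2 ⟨Finset.mem_univ _, 1, one_pos, hx⟩
  symm
  refine Finset.card_bij (fun x _ => x.trans (Function.Embedding.subtype _)) ?_ ?_ ?_
  · intro x hx
    simp only [Finset.mem_filter, Finset.mem_univ, true_and] at hx ⊢
    intro i
    simp [h, hx i]
  · intro x _ y _ hxy
    ext i
    exact congrArg Fin.val (DFunLike.congr_fun hxy i)
  · intro y hy
    simp only [Finset.mem_filter, Finset.mem_univ, true_and] at hy
    refine ⟨⟨fun i => ⟨y i, hmem _ (hy i)⟩, fun i j hij => y.injective (congrArg Subtype.val hij)⟩,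
      ?_, ?_⟩
    · simp only [Finset.mem_filter, Finset.mem_univ, true_and]
      intro i
      apply Subtype.ext
      rw [← h]
      exact hy i
    · ext i
      rfl

lemma sum_zkMapsOn_fixedTuples (A : Finset (Fin n)) (z : ℕ) :
    ∑ f ∈ zkMapsOn k A, (fixedTuples z f : ℝ)
      = if z ≤ A.card then ((zkMapsOn k A).card : ℝ) else 0 := by
  have h := sum_zkMapsOn_comp_perm (k := k) A (fun f => (fixedTuples z f : ℝ))
  have h2 : ∀ f ∈ zkMapsOn k A,
      ∑ τ : Equiv.Perm A, (fixedTuples z (f ∘ Equiv.Perm.ofSubtype τ) : ℝ)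
        = if z ≤ A.card then (A.card.factorial : ℝ) else 0 := by
    intro f hf
    obtain ⟨-, rfl⟩ := Finset.mem_filter.1 hf
    have h3 : ∀ τ : Equiv.Perm (cyclicSet f),
        fixedTuples z (f ∘ Equiv.Perm.ofSubtype τ) = fixedTuples z (cyclicPerm f * τ) :=
      fun τ => fixedTuples_eq_of_cyclicSet (cyclicSet_comp_ofSubtype τ)
        (comp_ofSubtype_apply τ) z
    rw [Finset.sum_congr rfl fun τ _ => by rw [h3 τ]]
    have h4 := Equiv.sum_comp (Equiv.mulLeft (cyclicPerm f))
      (fun σ : Equiv.Perm (cyclicSet f) => (fixedTuples z σ : ℝ))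
    simp only [Equiv.coe_mulLeft] at h4
    rw [h4, ← Nat.cast_sum, sum_fixedTuples_perm, Fintype.card_coe]
    push_cast
    rfl
  rw [Finset.sum_congr rfl h2, Finset.sum_const, nsmul_eq_mul] at h
  have hpos : (A.card.factorial : ℝ) ≠ 0 := by positivity
  apply mul_left_cancel₀ hpos
  rw [← h]
  split_ifs
  · ring
  · simp

lemma sum_zkMaps_fixedTuples (z : ℕ) :
    ∑ f ∈ zkMaps n k, (fixedTuples z f : ℝ)
      = (((zkMaps n k).filter fun f => z ≤ Zmap f).card : ℝ) := by
  rw [sum_zkMaps_eq_sum_zkMapsOn, Finset.card_filter, Nat.cast_sum, sum_zkMaps_eq_sum_zkMapsOn]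
  refine Finset.sum_congr rfl fun A _ => ?_
  rw [sum_zkMapsOn_fixedTuples]
  have h : ∀ f ∈ zkMapsOn k A, ((if z ≤ Zmap f then 1 else 0 : ℕ) : ℝ)
      = if z ≤ A.card then 1 else 0 := by
    intro f hf
    obtain ⟨-, rfl⟩ := Finset.mem_filter.1 hf
    simp only [Zmap]
    split_ifs with hz
    · simp [hz]
    · simp [hz]
  rw [Finset.sum_congr rfl h]
  simp

/-- The number of `{0,k}`-mappings sending `x i` to `y i` for all `i`. -/
def zkMapsThrough (k : ℕ) {z : ℕ} (x y : Fin z ↪ Fin n) : Finset (Fin n → Fin n) :=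
  (zkMaps n k).filter fun f => ∀ i, f (x i) = y i

lemma exists_perm_extending {α : Type*} [Fintype α] {z : ℕ} (x y : Fin z ↪ α) :
    ∃ π : Equiv.Perm α, ∀ i, π (x i) = y i := by
  obtain ⟨π, hπ⟩ := (Equiv.Perm.isMultiplyPretransitive α z).exists_smul_eq x y
  exact ⟨π, fun i => DFunLike.congr_fun hπ i⟩

lemma card_zkMapsThrough_eq {z : ℕ} (x y x' y' : Fin z ↪ Fin n) :
    (zkMapsThrough k x y).card = (zkMapsThrough k x' y').card := by
  obtain ⟨π, hπ⟩ := exists_perm_extending x' x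
  obtain ⟨ρ, hρ⟩ := exists_perm_extending y y'
  refine Finset.card_nbij' (fun f => ρ ∘ f ∘ π) (fun f => ρ.symm ∘ f ∘ π.symm) ?_ ?_ ?_ ?_
  · intro f hf
    obtain ⟨h1, h2⟩ := Finset.mem_filter.1 hf
    refine Finset.mem_filter.2 ⟨mem_zkMaps.2 ((mem_zkMaps.1 h1).comp_perm π ρ), fun i => ?_⟩
    simp [hπ, h2, hρ]
  · intro f hf
    obtain ⟨h1, h2⟩ := Finset.mem_filter.1 hf
    refine Finset.mem_filter.2
      ⟨mem_zkMaps.2 ((mem_zkMaps.1 h1).comp_perm π.symm ρ.symm), fun i => ?_⟩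
    simp [← hπ, h2, ← hρ]
  · intro f _
    ext x
    simp
  · intro f _
    ext x
    simp

lemma IsZKMap.mul_card_image {f : Fin n → Fin n} (hf : IsZKMap k f) :
    k * (Finset.univ.image f).card = n := by
  have h := Finset.card_eq_sum_card_image f Finset.univ
  have h2 : ∀ y ∈ Finset.univ.image f, (Finset.univ.filter fun x => f x = y).card = k := by
    intro y hy
    refine (hf y).resolve_left fun h0 => ?_
    obtain ⟨x, -, hx⟩ := Finset.mem_image.1 hy
    exact Finset.notMem_empty x (Finset.card_eq_zero.1 h0 ▸ by simp [hx])
  rw [Finset.sum_congr rfl h2] at h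
  simpa [mul_comm] using h.symm

lemma IsZKMap.card_injective_comp {r : ℕ} {f : Fin (k * r) → Fin (k * r)} (hk : 0 < k)
    (hf : IsZKMap k f) (z : ℕ) :
    ∑ y : Fin z ↪ Fin (k * r),
        (Finset.univ.filter fun x : Fin z ↪ Fin (k * r) => ∀ i, f (x i) = y i).card
      = k ^ z * r.descFactorial z := by
  have hR : (Finset.univ.image f).card = r := Nat.eq_of_mul_eq_mul_left hk hf.mul_card_image
  have h1 : ∀ y : Fin z ↪ Fin (k * r),
      (Finset.univ.filter fun x : Fin z ↪ Fin (k * r) => ∀ i, f (x i) = y i).card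
        = if ∀ i, y i ∈ Finset.univ.image f then k ^ z else 0 := by
    intro y
    have h2 : (Finset.univ.filter fun x : Fin z ↪ Fin (k * r) => ∀ i, f (x i) = y i).card
        = (Fintype.piFinset fun i => Finset.univ.filter fun x => f x = y i).card := by
      refine Finset.card_bij (fun x _ => x) ?_ ?_ ?_
      · intro x hx
        simpa [Fintype.mem_piFinset] using hx
      · intro x _ x' _ h
        exact DFunLike.coe_injective h
      · intro x hx
        simp only [Fintype.mem_piFinset, Finset.mem_filter, Finset.mem_univ, true_and] at hx
        refine ⟨⟨x, fun i j hij => y.injective ?_⟩,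
          Finset.mem_filter.2 ⟨Finset.mem_univ _, hx⟩, rfl⟩
        rw [← hx, ← hx, hij]
    rw [h2, Fintype.card_piFinset]
    split_ifs with hy
    · rw [Finset.prod_congr rfl fun i _ => ?_, Finset.prod_const, Finset.card_univ,
        Fintype.card_fin]
      refine (hf (y i)).resolve_left fun h0 => ?_
      obtain ⟨x, -, hx⟩ := Finset.mem_image.1 (hy i)
      exact Finset.notMem_empty x (Finset.card_eq_zero.1 h0 ▸ by simp [hx])
    · push Not at hy
      obtain ⟨i, hi⟩ := hy
      refine Finset.prod_eq_zero (Finset.mem_univ i) (Finset.card_eq_zero.2 ?_)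
      refine Finset.filter_eq_empty_iff.2 fun x _ hx => hi ?_
      exact Finset.mem_image.2 ⟨x, Finset.mem_univ _, hx⟩
  rw [Finset.sum_congr rfl fun y _ => h1 y, ← Finset.sum_filter, Finset.sum_const, smul_eq_mul,
    mul_comm]
  congr 1
  have h3 := Fintype.card_embedding_eq (α := Fin z) (β := (Finset.univ.image f))
  rw [Fintype.card_coe, hR, Fintype.card_fin] at h3
  rw [← h3, ← Fintype.card_subtype]
  refine Fintype.card_congr
    { toFun := fun y => ⟨fun i => ⟨y.1 i, y.2 i⟩,
        fun i j hij => y.1.injective (congrArg Subtype.val hij)⟩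
      invFun := fun y => ⟨y.trans (Function.Embedding.subtype _), fun i => (y i).2⟩
      left_inv := fun y => rfl
      right_inv := fun y => rfl }

/-- The exact tail of the number of cyclic nodes, in product form. -/
lemma card_le_Zmap_mul_descFactorial {r : ℕ} (hk : 0 < k) (z : ℕ) :
    (((zkMaps (k * r) k).filter fun f => z ≤ Zmap f).card : ℝ) * (k * r).descFactorial z
      = (zkMaps (k * r) k).card * (k ^ z * r.descFactorial z) := by
  set n := k * r with hn
  have hcard : Fintype.card (Fin z ↪ Fin n) = n.descFactorial z := by
    rw [Fintype.card_embedding_eq, Fintype.card_fin, Fintype.card_fin]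
  have h1 : ∑ f ∈ zkMaps n k, fixedTuples z f
      = ∑ x : Fin z ↪ Fin n, (zkMapsThrough k x x).card := by
    simp only [fixedTuples, zkMapsThrough, Finset.card_filter]
    rw [Finset.sum_comm]
    congr!
  have h2 : (∑ f ∈ zkMaps n k, fixedTuples z f) * n.descFactorial z
      = ∑ y : Fin z ↪ Fin n, ∑ x : Fin z ↪ Fin n, (zkMapsThrough k x y).card := by
    rw [h1, Finset.sum_comm (s := Finset.univ), Finset.sum_mul]
    refine Finset.sum_congr rfl fun x _ => ?_
    rw [Finset.sum_congr rfl fun y _ => card_zkMapsThrough_eq x y x x, Finset.sum_const,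
      Finset.card_univ, hcard, smul_eq_mul, mul_comm]
  have h3 : ∑ y : Fin z ↪ Fin n, ∑ x : Fin z ↪ Fin n, (zkMapsThrough k x y).card
      = ∑ f ∈ zkMaps n k, ∑ y : Fin z ↪ Fin n,
        (Finset.univ.filter fun x : Fin z ↪ Fin n => ∀ i, f (x i) = y i).card := by
    simp only [zkMapsThrough, Finset.card_filter]
    rw [Finset.sum_comm (s := zkMaps n k)]
    exact Finset.sum_congr rfl fun y _ => Finset.sum_comm
  rw [h3, Finset.sum_congr rfl fun f hf =>
    (mem_zkMaps.1 hf).card_injective_comp hk z, Finset.sum_const, smul_eq_mul] at h2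
  rw [← sum_zkMaps_fixedTuples]
  exact_mod_cast h2

end CyclicTail

section OrderBounds

variable {n : ℕ} {f : Fin n → Fin n}

lemma card_cycle_eq_minimalPeriod {x : Fin n} (hx : x ∈ cyclicSet f) :
    ((cyclicSet f).filter fun y => ∃ m, f^[m] x = y).card = Function.minimalPeriod f x := by
  have hp := mem_cyclicSet_iff.1 hx
  rw [← Finset.card_range (Function.minimalPeriod f x)]
  symm
  refine Finset.card_bij (fun i _ => f^[i] x) ?_ ?_ ?_
  · intro i _
    exact Finset.mem_filter.2 ⟨mem_cyclicSet_iff.2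
      (((Function.bijOn_periodicPts f).mapsTo.iterate i) hp), i, rfl⟩
  · intro i hi j hj hij
    exact Function.iterate_injOn_Iio_minimalPeriod (Finset.mem_range.1 hi)
      (Finset.mem_range.1 hj) hij
  · intro y hy
    obtain ⟨-, m, rfl⟩ := Finset.mem_filter.1 hy
    exact ⟨m % Function.minimalPeriod f x, Finset.mem_range.2
      (Nat.mod_lt _ (Function.minimalPeriod_pos_of_mem_periodicPts hp)),
      Function.iterate_mod_minimalPeriod_eq⟩

lemma Tmap_pos (f : Fin n → Fin n) : 0 < Tmap f := by
  refine Nat.pos_of_ne_zero fun h => ?_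
  obtain ⟨c, hc, h0⟩ := Finset.lcm_eq_zero_iff.1 h
  obtain ⟨x, hx, rfl⟩ := Finset.mem_image.1 hc
  rw [card_cycle_eq_minimalPeriod hx] at h0
  exact (Function.minimalPeriod_pos_of_mem_periodicPts (mem_cyclicSet_iff.1 hx)).ne' h0

lemma orderOf_le_Tmap {g : Fin n → Fin n} {A : Finset (Fin n)} (hA : cyclicSet g = A)
    {σ : Equiv.Perm A} (h : ∀ a : A, g a = σ a) : orderOf σ ≤ Tmap g := by
  subst hA
  refine orderOf_le_of_pow_eq_one (Tmap_pos g) ?_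
  ext a
  rw [← iterate_eq_coe_pow h, Equiv.Perm.one_apply]
  congr 1
  have h1 : Function.minimalPeriod g (a : Fin n) ∣ Tmap g := by
    rw [← card_cycle_eq_minimalPeriod a.2]
    exact Finset.dvd_lcm (Finset.mem_image_of_mem _ a.2)
  exact Function.isPeriodicPt_iff_minimalPeriod_dvd.2 h1

lemma pairwiseDisjoint_cyclesOf (f : Fin n → Fin n) :
    (cyclesOf f : Set (Finset (Fin n))).PairwiseDisjoint id := by
  have key : ∀ x ∈ cyclicSet f, ∀ y, y ∈ (cyclicSet f).filter (fun y => ∃ m, f^[m] x = y) →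
      (cyclicSet f).filter (fun w => ∃ m, f^[m] x = w)
        = (cyclicSet f).filter (fun w => ∃ m, f^[m] y = w) := by
    intro x hx y hy
    obtain ⟨-, i, rfl⟩ := Finset.mem_filter.1 hy
    obtain ⟨p, hp, hpx⟩ := (Finset.mem_filter.1 hx).2
    refine Finset.filter_congr fun w _ => ⟨?_, ?_⟩
    · rintro ⟨m, rfl⟩
      refine ⟨m + (p * i - i), ?_⟩
      rw [← Function.iterate_add_apply, add_assoc,
        Nat.sub_add_cancel (Nat.le_mul_of_pos_left i hp), Function.iterate_add_apply,
        Function.iterate_mul, Function.iterate_fixed hpx]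
    · rintro ⟨m, rfl⟩
      exact ⟨m + i, Function.iterate_add_apply f m i x⟩
  intro c hc d hd hcd
  obtain ⟨x, hx, rfl⟩ := Finset.mem_image.1 (Finset.mem_coe.1 hc)
  obtain ⟨y, hy, rfl⟩ := Finset.mem_image.1 (Finset.mem_coe.1 hd)
  refine Finset.disjoint_left.2 fun w hw hw' => hcd ?_
  exact (key x hx w hw).trans (key y hy w hw').symm

lemma sum_card_cyclesOf_le (f : Fin n → Fin n) : ∑ c ∈ cyclesOf f, c.card ≤ Zmap f := by
  have h := Finset.card_biUnion (s := cyclesOf f) (t := id)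
    fun c hc d hd hcd => pairwiseDisjoint_cyclesOf f hc hd hcd
  simp only [id] at h
  rw [← h]
  refine Finset.card_le_card fun w hw => ?_
  obtain ⟨c, hc, hwc⟩ := Finset.mem_biUnion.1 hw
  obtain ⟨x, -, rfl⟩ := Finset.mem_image.1 hc
  exact (Finset.mem_filter.1 hwc).1

/-- Cycles of length at most `y` contribute at most `lcm(1,…,y)` to `T`, and there are at most
`Z / y` longer ones. -/
lemma Tmap_le_lcmUpto_mul_pow (f : Fin n → Fin n) (y : ℕ) :
    ∃ b, b * y ≤ Zmap f ∧ Tmap f ≤ Nat.lcmUpto y * n ^ b := by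
  set big := (cyclesOf f).filter fun c => y < c.card with hbig
  refine ⟨big.card, ?_, ?_⟩
  · calc big.card * y = ∑ _c ∈ big, y := by rw [Finset.sum_const, smul_eq_mul]
      _ ≤ ∑ c ∈ big, c.card := Finset.sum_le_sum fun c hc => (Finset.mem_filter.1 hc).2.le
      _ ≤ ∑ c ∈ cyclesOf f, c.card := Finset.sum_le_sum_of_subset (Finset.filter_subset _ _)
      _ ≤ Zmap f := sum_card_cyclesOf_le f
  · have hpos : ∀ c ∈ cyclesOf f, 0 < c.card := by
      intro c hc
      obtain ⟨x, hx, rfl⟩ := Finset.mem_image.1 hc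
      rw [card_cycle_eq_minimalPeriod hx]
      exact Function.minimalPeriod_pos_of_mem_periodicPts (mem_cyclicSet_iff.1 hx)
    have hdvd : Tmap f ∣ Nat.lcmUpto y * ∏ c ∈ big, c.card := by
      refine Finset.lcm_dvd fun c hc => ?_
      by_cases hy : y < c.card
      · exact Dvd.dvd.mul_left (Finset.dvd_prod_of_mem _ (Finset.mem_filter.2 ⟨hc, hy⟩)) _
      · refine Dvd.dvd.mul_right ?_ _
        exact Finset.dvd_lcm (f := id) (Finset.mem_Icc.2 ⟨hpos c hc, not_lt.1 hy⟩)
    have hprod : 0 < ∏ c ∈ big, c.card :=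
      Finset.prod_pos fun c hc => hpos c (Finset.mem_filter.1 hc).1
    refine (Nat.le_of_dvd (Nat.mul_pos (Nat.lcmUpto_pos y) hprod) hdvd).trans ?_
    refine Nat.mul_le_mul_left _ (Finset.prod_le_pow_card _ _ _ fun c _ => ?_)
    exact (Finset.card_le_univ c).trans (Fintype.card_fin n).le

lemma log_Tmap_le (f : Fin n → Fin n) (hn : 0 < n) {y : ℝ} (hy : 1 ≤ y) :
    Real.log (Tmap f) ≤ (Real.log 4 + 4) * y + 2 * Zmap f / y * Real.log n := by
  obtain ⟨b, hb, hT⟩ := Tmap_le_lcmUpto_mul_pow f ⌊y⌋₊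
  have hT' : (Tmap f : ℝ) ≤ Nat.lcmUpto ⌊y⌋₊ * (n : ℝ) ^ b := by exact_mod_cast hT
  have h1 : (0 : ℝ) < Nat.lcmUpto ⌊y⌋₊ := by exact_mod_cast Nat.lcmUpto_pos _
  have h2 : (0 : ℝ) < (n : ℝ) ^ b := by positivity
  have h3 := Real.log_le_log (by exact_mod_cast Tmap_pos f) hT'
  rw [Real.log_mul h1.ne' h2.ne', Real.log_pow, ← Chebyshev.psi_eq_log_lcmUpto,
    ← Chebyshev.psi_eq_psi_coe_floor] at h3
  have h4 := Chebyshev.psi_le_const_mul_self (x := y) (by linarith)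
  have h5 : (b : ℝ) ≤ 2 * Zmap f / y := by
    rw [le_div_iff₀ (by linarith)]
    have h6 : (b : ℝ) * ⌊y⌋₊ ≤ Zmap f := by exact_mod_cast hb
    have h7 : y ≤ 2 * ⌊y⌋₊ := by
      have h8 : (1 : ℝ) ≤ ⌊y⌋₊ := by exact_mod_cast Nat.one_le_floor_iff y |>.2 hy
      have := Nat.lt_floor_add_one y
      linarith
    nlinarith [(Nat.cast_nonneg b : (0 : ℝ) ≤ b)]
  have h9 : 0 ≤ Real.log n := Real.log_natCast_nonneg n
  nlinarith [mul_le_mul_of_nonneg_right h5 h9]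

end OrderBounds

section AverageOrder

/-- Averaging the order over the permutations whose cycle lengths form a set of primes taken
from `S₀`, together with one longer cycle. -/
lemma two_pow_mul_factorial_le_sum_orderOf {α : Type*} [Fintype α] [DecidableEq α]
    {S₀ : Finset ℕ} {y : ℕ} (hprime : ∀ p ∈ S₀, p.Prime) (hle : ∀ p ∈ S₀, p ≤ y)
    (hy : 1 ≤ y) (hcard : S₀.card * y + y < Fintype.card α) :
    2 ^ S₀.card * (Fintype.card α).factorial
      ≤ Fintype.card α * ∑ σ : Equiv.Perm α, orderOf σ := by
  set j := Fintype.card α with hj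
  set M : Finset ℕ → Multiset ℕ := fun S => (j - S.sum id) ::ₘ S.val with hM
  have hsum : ∀ S ∈ S₀.powerset, S.sum id + y < j := by
    intro S hS
    have hS := Finset.mem_powerset.1 hS
    have h1 : S.sum id ≤ S.card * y := by
      simpa using Finset.sum_le_card_nsmul S id y fun p hp => hle p (hS hp)
    have h2 : S.card * y ≤ S₀.card * y := Nat.mul_le_mul_right _ (Finset.card_le_card hS)
    omega
  have hinj : ∀ S ∈ S₀.powerset, ∀ S' ∈ S₀.powerset, M S = M S' → S = S' := by
    have hmem : ∀ S ∈ S₀.powerset, ∀ p, p ∈ S ↔ p ∈ M S ∧ p ≤ y := by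
      intro S hS p
      have h1 := hsum S hS
      simp only [hM, Multiset.mem_cons, Finset.mem_val]
      constructor
      · exact fun hp => ⟨Or.inr hp, hle p (Finset.mem_powerset.1 hS hp)⟩
      · rintro ⟨rfl | hp, h2⟩
        · omega
        · exact hp
    intro S hS S' hS' h
    ext p
    rw [hmem S hS, hmem S' hS', h]
  have hfiber : ∀ S ∈ S₀.powerset, j.factorial
      ≤ j * ∑ σ ∈ Finset.univ.filter (fun σ : Equiv.Perm α => σ.cycleType = M S),
        orderOf σ := by
    intro S hS
    have hlt := hsum S hS
    have hSS := Finset.mem_powerset.1 hS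
    have hMsum : (M S).sum = j := by
      have : S.val.sum = S.sum id := Finset.sum_val S
      simp only [hM, Multiset.sum_cons, this]
      omega
    have hMprod : (M S).prod = (j - S.sum id) * ∏ p ∈ S, p := by
      simp only [hM, Multiset.prod_cons, Finset.prod_val, id]
    have hnodup : (M S).Nodup := by
      refine Multiset.nodup_cons.2 ⟨fun h => ?_, S.nodup⟩
      have := hle _ (hSS h)
      omega
    have h2 : ∀ a ∈ M S, 2 ≤ a := by
      intro a ha
      rcases Multiset.mem_cons.1 ha with rfl | ha
      · omega
      · exact (hprime a (hSS ha)).two_le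
    have hcount := Equiv.Perm.card_of_cycleType_mul_eq α (M S)
    rw [if_pos ⟨by rw [hMsum], h2⟩, hMsum, ← hj, Nat.sub_self, Nat.factorial_zero, one_mul,
      Finset.prod_eq_one (fun p hp => by
        rw [Multiset.count_eq_one_of_mem hnodup (Multiset.mem_toFinset.1 hp),
          Nat.factorial_one]), mul_one, hMprod] at hcount
    have horder : ∀ σ ∈ Finset.univ.filter (fun σ : Equiv.Perm α => σ.cycleType = M S),
        ∏ p ∈ S, p ≤ orderOf σ := by
      intro σ hσ
      refine Nat.le_of_dvd (orderOf_pos σ) ?_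
      refine Finset.prod_primes_dvd _ (fun p hp => (hprime p (hSS hp)).prime) fun p hp => ?_
      rw [← Equiv.Perm.lcm_cycleType, (Finset.mem_filter.1 hσ).2]
      exact Multiset.dvd_lcm (Multiset.mem_cons_of_mem hp)
    have h3 := Finset.card_nsmul_le_sum _ _ _ horder
    rw [smul_eq_mul] at h3
    calc j.factorial = (j - S.sum id) * (_ * ∏ p ∈ S, p) := by rw [← hcount]; ring
      _ ≤ j * _ := Nat.mul_le_mul (Nat.sub_le _ _) h3
  have hdisj : (S₀.powerset : Set (Finset ℕ)).PairwiseDisjoint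
      fun S => Finset.univ.filter (fun σ : Equiv.Perm α => σ.cycleType = M S) := by
    intro S hS S' hS' hne
    refine Finset.disjoint_left.2 fun σ h1 h2 => hne (hinj S hS S' hS' ?_)
    rw [← (Finset.mem_filter.1 h1).2, (Finset.mem_filter.1 h2).2]
  calc 2 ^ S₀.card * j.factorial = ∑ _S ∈ S₀.powerset, j.factorial := by
        rw [Finset.sum_const, Finset.card_powerset, smul_eq_mul]
    _ ≤ ∑ S ∈ S₀.powerset, j * ∑ σ ∈ Finset.univ.filter
          (fun σ : Equiv.Perm α => σ.cycleType = M S), orderOf σ := Finset.sum_le_sum hfiber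
    _ = j * ∑ σ ∈ S₀.powerset.biUnion fun S => Finset.univ.filter
          (fun σ : Equiv.Perm α => σ.cycleType = M S), orderOf σ := by
        rw [← Finset.mul_sum, Finset.sum_biUnion hdisj]
    _ ≤ j * ∑ σ : Equiv.Perm α, orderOf σ :=
        Nat.mul_le_mul_left _ (Finset.sum_le_sum_of_subset (Finset.subset_univ _))

variable {n k : ℕ}

lemma two_pow_mul_card_le_sum_Tmap {S₀ : Finset ℕ} {y m : ℕ} (hprime : ∀ p ∈ S₀, p.Prime)
    (hle : ∀ p ∈ S₀, p ≤ y) (hy : 1 ≤ y) (hm : S₀.card * y + y < m) :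
    (2 : ℝ) ^ S₀.card * ((zkMaps n k).filter fun f => m ≤ Zmap f).card
      ≤ n * ∑ f ∈ zkMaps n k, (Tmap f : ℝ) := by
  rw [Finset.card_filter, Nat.cast_sum, sum_zkMaps_eq_sum_zkMapsOn, sum_zkMaps_eq_sum_zkMapsOn,
    Finset.mul_sum, Finset.mul_sum]
  refine Finset.sum_le_sum fun A _ => ?_
  have hfact : (0 : ℝ) < A.card.factorial := by positivity
  refine le_of_mul_le_mul_left ?_ hfact
  have h := sum_zkMapsOn_comp_perm (k := k) A (fun f => (Tmap f : ℝ))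
  rw [mul_left_comm _ (n : ℝ), ← h, Finset.mul_sum, Finset.mul_sum, Finset.mul_sum]
  refine Finset.sum_le_sum fun f hf => ?_
  obtain ⟨-, rfl⟩ := Finset.mem_filter.1 hf
  split_ifs with hz
  · have h1 := two_pow_mul_factorial_le_sum_orderOf (α := cyclicSet f) hprime hle hy
      (by rw [Fintype.card_coe]; exact hm.trans_le hz)
    rw [Fintype.card_coe] at h1
    have h2 : ∑ σ : Equiv.Perm (cyclicSet f), orderOf σ
        ≤ ∑ τ : Equiv.Perm (cyclicSet f), Tmap (f ∘ Equiv.Perm.ofSubtype τ) := by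
      rw [← Equiv.sum_comp (Equiv.mulLeft (cyclicPerm f))]
      refine Finset.sum_le_sum fun τ _ => ?_
      exact orderOf_le_Tmap (cyclicSet_comp_ofSubtype τ) (comp_ofSubtype_apply τ)
    have h3 : (cyclicSet f).card ≤ n := (Finset.card_le_univ _).trans (Fintype.card_fin n).le
    have h4 := h1.trans (Nat.mul_le_mul h3 h2)
    have h5 : (2 : ℝ) ^ S₀.card * (cyclicSet f).card.factorial
        ≤ n * ∑ τ : Equiv.Perm (cyclicSet f), (Tmap (f ∘ Equiv.Perm.ofSubtype τ) : ℝ) := by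
      exact_mod_cast h4
    simpa [mul_comm] using h5
  · simp only [Nat.cast_zero, mul_zero]
    positivity

end AverageOrder

section TailBounds

lemma cast_descFactorial_succ_le (m z : ℕ) :
    ((m.descFactorial (z + 1) : ℕ) : ℝ) = ((m - z : ℕ) : ℝ) * m.descFactorial z := by
  rw [Nat.descFactorial_succ]
  push_cast
  rfl

lemma pow_mul_descFactorial_le {k r : ℕ} (hk : 1 ≤ k) {z : ℕ} (hz : z ≤ k * r) :
    (k : ℝ) ^ z * r.descFactorial z
      ≤ (k * r).descFactorial z
        * Real.exp (-(((k : ℝ) - 1) * (z * (z - 1)) / (2 * (k * r : ℕ)))) := by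
  induction z with
  | zero => simp
  | succ z ih =>
    have hn : (0 : ℝ) < (k * r : ℕ) := by exact_mod_cast (by omega : 0 < k * r)
    have hk1 : (1 : ℝ) ≤ k := by exact_mod_cast hk
    have hzn : (z : ℝ) ≤ (k * r : ℕ) := by exact_mod_cast (by omega : z ≤ k * r)
    have step : (k : ℝ) * (r - z : ℕ)
        ≤ (k * r - z : ℕ) * Real.exp (-(((k : ℝ) - 1) * z / (k * r : ℕ))) := by
      rcases le_or_gt r z with h | h
      · rw [Nat.sub_eq_zero_of_le h]
        simp only [Nat.cast_zero, mul_zero]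
        positivity
      · rw [Nat.cast_sub h.le, Nat.cast_sub (by omega : z ≤ k * r)]
        have h1 := Real.add_one_le_exp (-(((k : ℝ) - 1) * z / (k * r : ℕ)))
        have h2 := mul_le_mul_of_nonneg_left h1 (sub_nonneg.2 hzn)
        refine le_trans ?_ h2
        have h3 : (((k * r : ℕ) : ℝ) - z) * (-(((k : ℝ) - 1) * z / (k * r : ℕ)) + 1)
            = k * (r - z) + (k - 1) * z ^ 2 / (k * r : ℕ) := by
          field_simp
          push_cast
          ring
        rw [h3]
        have : 0 ≤ ((k : ℝ) - 1) * z ^ 2 / (k * r : ℕ) :=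
          div_nonneg (mul_nonneg (by linarith) (by positivity)) hn.le
        linarith
    have hmul := mul_le_mul step (ih (by omega)) (by positivity) (by positivity)
    rw [cast_descFactorial_succ_le, cast_descFactorial_succ_le]
    calc (k : ℝ) ^ (z + 1) * ((r - z : ℕ) * r.descFactorial z)
        = k * (r - z : ℕ) * (k ^ z * r.descFactorial z) := by ring
      _ ≤ _ := hmul
      _ = (k * r - z : ℕ) * (k * r).descFactorial z
          * (Real.exp (-(((k : ℝ) - 1) * z / (k * r : ℕ)))
            * Real.exp (-(((k : ℝ) - 1) * (z * (z - 1)) / (2 * (k * r : ℕ))))) := by ring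
      _ = _ := by
        rw [← Real.exp_add]
        congr 2
        rw [Nat.cast_add, Nat.cast_one]
        field_simp
        ring

lemma exp_neg_two_mul_le {t : ℝ} (h0 : 0 ≤ t) (h : t ≤ 1 / 2) :
    Real.exp (-(2 * t)) ≤ 1 - t := by
  rw [Real.exp_neg, inv_le_comm₀ (Real.exp_pos _) (by linarith)]
  refine le_trans ?_ (Real.add_one_le_exp _)
  rw [inv_le_iff_one_le_mul₀ (by linarith)]
  nlinarith

lemma descFactorial_mul_exp_le {k r : ℕ} (hk : 1 ≤ k) {z : ℕ} (hz : 2 * k * z ≤ k * r) :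
    (k * r).descFactorial z * Real.exp (-(k * z ^ 2 / (k * r : ℕ)))
      ≤ (k : ℝ) ^ z * r.descFactorial z := by
  induction z with
  | zero => simp
  | succ z ih =>
    have hkz : 2 * k * z + 2 * k ≤ k * r := by linarith
    have hn : (0 : ℝ) < (k * r : ℕ) := by exact_mod_cast (by omega : 0 < k * r)
    have hzr : z ≤ r := by
      refine Nat.le_of_mul_le_mul_left ?_ hk
      nlinarith
    have hzn : z ≤ k * r := hzr.trans (Nat.le_mul_of_pos_left r hk)
    have step : ((k * r - z : ℕ) : ℝ) * Real.exp (-(2 * (k * z / (k * r : ℕ))))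
        ≤ k * (r - z : ℕ) := by
      have h1 := exp_neg_two_mul_le (t := k * z / (k * r : ℕ)) (by positivity) (by
        rw [div_le_iff₀ hn]
        have : (2 : ℝ) * k * z ≤ (k * r : ℕ) := by exact_mod_cast (by omega)
        linarith)
      have h2 : ((k * r - z : ℕ) : ℝ) ≤ (k * r : ℕ) := by exact_mod_cast Nat.sub_le _ _
      calc _ ≤ ((k * r : ℕ) : ℝ) * (1 - k * z / (k * r : ℕ)) :=
            mul_le_mul h2 h1 (Real.exp_pos _).le hn.le
        _ = k * (r - z : ℕ) := by
            rw [Nat.cast_sub hzr]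
            field_simp
            push_cast
            ring
    have hmul := mul_le_mul step (ih (by omega)) (by positivity) (by positivity)
    rw [cast_descFactorial_succ_le, cast_descFactorial_succ_le]
    calc _ ≤ ((k * r - z : ℕ) : ℝ) * (k * r).descFactorial z
          * (Real.exp (-(2 * (k * z / (k * r : ℕ)))) * Real.exp (-(k * z ^ 2 / (k * r : ℕ)))) := by
          rw [← Real.exp_add]
          refine mul_le_mul_of_nonneg_left (Real.exp_le_exp.2 ?_) (by positivity)
          rw [← neg_add, neg_le_neg_iff, mul_div_assoc', ← add_div]
          refine div_le_div_of_nonneg_right ?_ hn.le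
          push_cast
          nlinarith [(Nat.cast_nonneg k : (0 : ℝ) ≤ k)]
      _ = ((k * r - z : ℕ) : ℝ) * Real.exp (-(2 * (k * z / (k * r : ℕ))))
          * ((k * r).descFactorial z * Real.exp (-(k * z ^ 2 / (k * r : ℕ)))) := by ring
      _ ≤ _ := hmul
      _ = _ := by ring

lemma card_le_Zmap_le {k r : ℕ} (hk : 1 ≤ k) (z : ℕ) :
    (((zkMaps (k * r) k).filter fun f => z ≤ Zmap f).card : ℝ)
      ≤ (zkMaps (k * r) k).card
        * Real.exp (-(((k : ℝ) - 1) * (z * (z - 1)) / (2 * (k * r : ℕ)))) := by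
  rcases le_or_gt z (k * r) with hz | hz
  · have hpos : (0 : ℝ) < (k * r).descFactorial z := by
      exact_mod_cast Nat.descFactorial_pos.2 hz
    refine le_of_mul_le_mul_right ?_ hpos
    rw [card_le_Zmap_mul_descFactorial hk, mul_assoc]
    refine mul_le_mul_of_nonneg_left ?_ (by positivity)
    rw [mul_comm (Real.exp _)]
    exact pow_mul_descFactorial_le hk hz
  · rw [Finset.card_eq_zero.2 (Finset.filter_eq_empty_iff.2 fun f _ => ?_)]
    · simp only [Nat.cast_zero]
      positivity
    · have : Zmap f ≤ k * r := (Finset.card_le_univ _).trans (Fintype.card_fin _).le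
      omega

lemma le_card_le_Zmap {k r : ℕ} (hk : 1 ≤ k) {z : ℕ} (hz : 2 * k * z ≤ k * r) :
    (zkMaps (k * r) k).card * Real.exp (-(k * z ^ 2 / (k * r : ℕ)))
      ≤ (((zkMaps (k * r) k).filter fun f => z ≤ Zmap f).card : ℝ) := by
  have hzn : z ≤ k * r := le_trans (by nlinarith) hz
  have hpos : (0 : ℝ) < (k * r).descFactorial z := by
    exact_mod_cast Nat.descFactorial_pos.2 hzn
  refine le_of_mul_le_mul_right ?_ hpos
  rw [card_le_Zmap_mul_descFactorial hk, mul_assoc]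
  refine mul_le_mul_of_nonneg_left ?_ (by positivity)
  rw [mul_comm (Real.exp _)]
  exact descFactorial_mul_exp_le hk hz

end TailBounds

section Asymptotics

lemma exists_primes_card_eq {y s : ℕ} (hs : s ≤ Nat.primeCounting y) :
    ∃ S : Finset ℕ, S.card = s ∧ (∀ p ∈ S, p.Prime) ∧ ∀ p ∈ S, p ≤ y := by
  rw [← Nat.primesLE_card_eq_primeCounting] at hs
  obtain ⟨S, hS, hcard⟩ := Finset.exists_subset_card_eq hs
  exact ⟨S, hcard, fun p hp => (Nat.mem_primesLE.1 (hS hp)).2,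
    fun p hp => (Nat.mem_primesLE.1 (hS hp)).1⟩

lemma div_two_log_le_primeCounting {y : ℕ} (hy : 899 ≤ y) :
    (y : ℝ) / (2 * Real.log y) ≤ Nat.primeCounting y := by
  refine le_trans ?_ (Chebyshev.pi_ge y)
  have hy' : (899 : ℝ) ≤ y := by exact_mod_cast hy
  have hlog : 0 < Real.log y := Real.log_pos (by linarith)
  have h1 : Real.log ((y : ℝ) + 1) ≤ 0.19 * y := by
    have h2 : (0 : ℝ) ≤ y + 1 := by linarith
    have h3 := Real.log_le_self (Real.sqrt_nonneg ((y : ℝ) + 1))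
    rw [Real.log_sqrt h2] at h3
    have h4 : (30 : ℝ) ≤ Real.sqrt (y + 1) := Real.le_sqrt_of_sq_le (by linarith)
    have h5 := Real.sq_sqrt h2
    nlinarith
  rw [← div_div]
  refine div_le_div_of_nonneg_right ?_ hlog.le
  nlinarith [Real.log_two_gt_d9]

lemma exp_le_zkExp_Tmap {k r : ℕ} (hk : 1 ≤ k) {ℓ w : ℝ} (hℓ : 1 ≤ ℓ)
    (hlog : Real.log (k * r : ℕ) = ℓ ^ 3) (hw : w ^ 3 = (k * r : ℕ))
    (hbig : 900 * k * ℓ ^ 9 ≤ w) (hne : (zkMaps (k * r) k).Nonempty) :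
    Real.exp (w / ℓ ^ 2 / (360 * k)) ≤ zkExp (k * r) k fun f => (Tmap f : ℝ) := by
  have hk1 : (1 : ℝ) ≤ k := by exact_mod_cast hk
  have hℓ0 : 0 < ℓ := by linarith
  have hℓ3 : 1 ≤ ℓ ^ 3 := one_le_pow₀ hℓ
  obtain ⟨u, hu⟩ : ∃ u, u = w / ℓ ^ 2 := ⟨_, rfl⟩
  obtain ⟨v, hv⟩ : ∃ v, v = u / (90 * k) := ⟨_, rfl⟩
  have hwu : w = u * ℓ ^ 2 := by rw [hu]; field_simp
  have huv : u = 90 * k * v := by rw [hv]; field_simp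
  have hn : ((k * r : ℕ) : ℝ) = u ^ 3 * ℓ ^ 6 := by rw [← hw, hwu]; ring
  have hvℓ : 10 * ℓ ^ 3 ≤ v := by
    have h1 : 900 * k * ℓ ^ 7 ≤ u := by
      rw [hu, le_div_iff₀ (by positivity)]
      linarith
    have h2 : ℓ ^ 3 ≤ ℓ ^ 7 := pow_le_pow_right₀ hℓ (by norm_num)
    rw [hv, le_div_iff₀ (by positivity)]
    nlinarith
  have hv10 : 10 ≤ v := by linarith
  have hu900 : 900 ≤ u := by nlinarith
  set y := ⌊u * ℓ ^ 3⌋₊ with hy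
  set s := ⌊v⌋₊ with hs
  have hyu : (y : ℝ) ≤ u * ℓ ^ 3 := Nat.floor_le (by positivity)
  have hyl : u * ℓ ^ 3 < y + 1 := Nat.lt_floor_add_one _
  have hsv : (s : ℝ) ≤ v := Nat.floor_le (by positivity)
  have hsl : v < s + 1 := Nat.lt_floor_add_one _
  have hy899 : 899 ≤ y := Nat.le_floor (by push_cast; nlinarith)
  have hy899' : (899 : ℝ) ≤ y := by exact_mod_cast hy899
  have hsπ : s ≤ Nat.primeCounting y := by
    have h1 : (s : ℝ) ≤ Nat.primeCounting y := by
      refine le_trans ?_ (div_two_log_le_primeCounting hy899)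
      have hlogy : 0 < Real.log y := Real.log_pos (by linarith)
      have hlogn : Real.log y ≤ ℓ ^ 3 := by
        rw [← hlog]
        refine Real.log_le_log (by linarith) (hyu.trans ?_)
        rw [hn]
        have h2 : u * ℓ ^ 3 * 1 ≤ u * ℓ ^ 3 * (u ^ 2 * ℓ ^ 3) := by
          refine mul_le_mul_of_nonneg_left ?_ (by positivity)
          nlinarith
        linarith [show u * ℓ ^ 3 * (u ^ 2 * ℓ ^ 3) = u ^ 3 * ℓ ^ 6 by ring]
      rw [le_div_iff₀ (by positivity)]
      have h3 : (s : ℝ) * (2 * Real.log y) ≤ v * (2 * ℓ ^ 3) :=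
        mul_le_mul hsv (by linarith) (by positivity) (by positivity)
      have h4 : 90 * v ≤ u := by nlinarith
      nlinarith
    exact_mod_cast h1
  obtain ⟨S, hScard, hSprime, hSle⟩ := exists_primes_card_eq hsπ
  set m := ⌊2 * v * u * ℓ ^ 3⌋₊ + 1 with hm
  have huℓ : 0 ≤ u * ℓ ^ 3 := by positivity
  have hsym : S.card * y + y < m := by
    rw [hScard, hm, Nat.lt_add_one_iff]
    refine Nat.le_floor ?_
    push_cast
    calc (s : ℝ) * y + y = (s + 1) * y := by ring
      _ ≤ (2 * v) * (u * ℓ ^ 3) := mul_le_mul (by linarith) hyu (by positivity) (by positivity)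
      _ = _ := by ring
  have hm3 : (m : ℝ) ≤ 3 * v * u * ℓ ^ 3 := by
    have h1 : (⌊2 * v * u * ℓ ^ 3⌋₊ : ℝ) ≤ 2 * v * u * ℓ ^ 3 := Nat.floor_le (by positivity)
    have h2 : 1 ≤ v * (u * ℓ ^ 3) := by
      have : 1 ≤ u * ℓ ^ 3 := by nlinarith
      nlinarith
    rw [hm]
    push_cast
    nlinarith
  have hn0 : (0 : ℝ) < (k * r : ℕ) := by rw [hn]; positivity
  have h2km : 2 * k * m ≤ k * r := by
    have h1 : (2 : ℝ) * k * m ≤ (k * r : ℕ) := by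
      rw [hn]
      calc (2 : ℝ) * k * m ≤ 2 * k * (3 * v * u * ℓ ^ 3) := by gcongr
        _ = u ^ 2 * ℓ ^ 3 * (1 / 15) := by rw [huv]; ring
        _ ≤ u ^ 2 * ℓ ^ 3 * (u * ℓ ^ 3) := by
          refine mul_le_mul_of_nonneg_left ?_ (by positivity)
          nlinarith
        _ = _ := by ring
    exact_mod_cast h1
  have hkm : k * (m : ℝ) ^ 2 / (k * r : ℕ) ≤ v / 10 := by
    rw [div_le_iff₀ hn0, hn]
    calc k * (m : ℝ) ^ 2 ≤ k * (3 * v * u * ℓ ^ 3) ^ 2 := by gcongr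
      _ = v / 10 * (u ^ 3 * ℓ ^ 6) := by rw [huv]; ring
  have hF : (0 : ℝ) < (zkMaps (k * r) k).card := by exact_mod_cast Finset.card_pos.2 hne
  have htail := le_card_le_Zmap hk h2km
  have hmain := two_pow_mul_card_le_sum_Tmap (n := k * r) (k := k) hSprime hSle (by omega) hsym
  rw [hScard] at hmain
  have hexpn : ((k * r : ℕ) : ℝ) = Real.exp (ℓ ^ 3) := by rw [← hlog, Real.exp_log hn0]
  have h2s : Real.exp (0.69 * (0.9 * v)) ≤ (2 : ℝ) ^ s := by
    rw [← Real.exp_log (by norm_num : (0 : ℝ) < 2), ← Real.exp_nat_mul]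
    refine Real.exp_le_exp.2 ?_
    have := Real.log_two_gt_d9
    nlinarith
  rw [zkExp, le_div_iff₀ hF]
  refine le_of_mul_le_mul_left ?_ hn0
  refine le_trans ?_ hmain
  calc ((k * r : ℕ) : ℝ) * (Real.exp (w / ℓ ^ 2 / (360 * k)) * (zkMaps (k * r) k).card)
      = Real.exp (ℓ ^ 3 + w / ℓ ^ 2 / (360 * k)) * (zkMaps (k * r) k).card := by
        rw [hexpn, Real.exp_add]; ring
    _ ≤ Real.exp (0.69 * (0.9 * v) + -(v / 10)) * (zkMaps (k * r) k).card := by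
        refine mul_le_mul_of_nonneg_right (Real.exp_le_exp.2 ?_) hF.le
        have : w / ℓ ^ 2 / (360 * k) = v / 4 := by
          rw [← hu, huv, div_eq_div_iff (by positivity) (by norm_num)]
          ring
        rw [this]
        linarith
    _ = Real.exp (0.69 * (0.9 * v)) * ((zkMaps (k * r) k).card * Real.exp (-(v / 10))) := by
        rw [Real.exp_add]; ring
    _ ≤ _ := by
        refine mul_le_mul h2s (le_trans ?_ htail)
          (mul_nonneg hF.le (Real.exp_pos _).le) (by positivity)
        refine mul_le_mul_of_nonneg_left (Real.exp_le_exp.2 (neg_le_neg hkm)) hF.le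

lemma zkProb_lt {k r : ℕ} (hk : 2 ≤ k) {a ℓ w : ℝ} (hℓ : 1 ≤ ℓ)
    (hlog : Real.log (k * r : ℕ) = ℓ ^ 3) (hw : w ^ 3 = (k * r : ℕ))
    (hbig : 900 * k * ℓ ^ 9 ≤ w) (ha : 2880 * k ≤ a * ℓ) :
    zkProb (k * r) k
        (fun f => (zkExp (k * r) k fun g => (Tmap g : ℝ)) ^ a ≤ (Tmap f : ℝ))
      < Real.exp (-(((k : ℝ) - 1) * w / (3 * (ℓ ^ 3) ^ 6))) := by
  rcases (zkMaps (k * r) k).eq_empty_or_nonempty with hempty | hne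
  · simp only [zkProb, hempty, Finset.card_empty, Nat.cast_zero, div_zero]
    exact Real.exp_pos _
  have hk2 : (2 : ℝ) ≤ k := by exact_mod_cast hk
  have hℓ0 : 0 < ℓ := by linarith
  have hℓ9 : 1 ≤ ℓ ^ 9 := one_le_pow₀ hℓ
  have hw9 : 1800 * ℓ ^ 9 ≤ w := by nlinarith
  have hw0 : 0 < w := by nlinarith
  have ha0 : 0 ≤ a := by
    by_contra h
    nlinarith
  have hn0 : (0 : ℝ) < (k * r : ℕ) := by rw [← hw]; positivity
  have hF : (0 : ℝ) < (zkMaps (k * r) k).card := by exact_mod_cast Finset.card_pos.2 hne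
  set t := 8 * w / ℓ ^ 3 with ht
  have ht12 : 12 ≤ t := by
    rw [ht, le_div_iff₀ (by positivity)]
    have : ℓ ^ 3 ≤ ℓ ^ 9 := pow_le_pow_right₀ hℓ (by norm_num)
    nlinarith
  have hξ : Real.exp t ≤ (zkExp (k * r) k fun g => (Tmap g : ℝ)) ^ a := by
    refine le_trans ?_ (Real.rpow_le_rpow (Real.exp_pos _).le
      (exp_le_zkExp_Tmap (by omega) hℓ hlog hw hbig hne) ha0)
    rw [← Real.exp_mul]
    refine Real.exp_le_exp.2 ?_
    have h1 : w / ℓ ^ 2 / (360 * k) * a = (w / (ℓ ^ 3 * (360 * k))) * (a * ℓ) := by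
      field_simp
    have h2 : t = (w / (ℓ ^ 3 * (360 * k))) * (2880 * k) := by
      rw [ht]
      field_simp
      norm_num
    rw [h1, h2]
    exact mul_le_mul_of_nonneg_left ha (by positivity)
  set V := 4 * w ^ 2 / (3 * ℓ ^ 9) with hV
  have hV2 : 10 ≤ V := by
    rw [hV, le_div_iff₀ (by positivity)]
    nlinarith
  set z := ⌈V⌉₊ with hz
  have hsub : ((zkMaps (k * r) k).filter
      fun f => (zkExp (k * r) k fun g => (Tmap g : ℝ)) ^ a ≤ (Tmap f : ℝ))
      ⊆ (zkMaps (k * r) k).filter fun f => z ≤ Zmap f := by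
    intro f hf
    obtain ⟨hfF, hfT⟩ := Finset.mem_filter.1 hf
    refine Finset.mem_filter.2 ⟨hfF, Nat.ceil_le.2 ?_⟩
    have h1 := (Real.le_log_iff_exp_le (by exact_mod_cast Tmap_pos f)).2 (hξ.trans hfT)
    have h2 := log_Tmap_le f (by exact_mod_cast hn0) (y := t / 12) (by linarith)
    rw [hlog] at h2
    have h3 : (Real.log 4 + 4) * (t / 12) ≤ t / 2 := by
      have h4 : Real.log 4 = 2 * Real.log 2 := by
        rw [show (4 : ℝ) = 2 ^ 2 by norm_num, Real.log_pow]
        norm_num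
      have := Real.log_two_lt_d9
      nlinarith
    have h5 : t / 2 ≤ 2 * Zmap f / (t / 12) * ℓ ^ 3 := by linarith
    have h6 : 2 * (Zmap f : ℝ) / (t / 12) * ℓ ^ 3 = 24 * Zmap f * ℓ ^ 3 / t := by
      field_simp
      ring
    rw [h6, le_div_iff₀ (by linarith)] at h5
    have h7 : V = t ^ 2 / (48 * ℓ ^ 3) := by
      rw [hV, ht]
      field_simp
      norm_num
    rw [h7, div_le_iff₀ (by positivity)]
    nlinarith
  have hcard : (((zkMaps (k * r) k).filter
      fun f => (zkExp (k * r) k fun g => (Tmap g : ℝ)) ^ a ≤ (Tmap f : ℝ)).card : ℝ)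
      ≤ ((zkMaps (k * r) k).filter fun f => z ≤ Zmap f).card := by
    exact_mod_cast Finset.card_le_card hsub
  have htail := hcard.trans (card_le_Zmap_le (by omega : 1 ≤ k) z)
  rw [zkProb, div_lt_iff₀ hF]
  refine htail.trans_lt ?_
  rw [mul_comm]
  refine mul_lt_mul_of_pos_right (Real.exp_lt_exp.2 (neg_lt_neg ?_)) hF
  have hzV : V ≤ z := Nat.le_ceil V
  have hzz : 0.9 * V ^ 2 ≤ (z : ℝ) * (z - 1) := by nlinarith
  have hk1 : (0 : ℝ) < k - 1 := by linarith
  calc ((k : ℝ) - 1) * w / (3 * (ℓ ^ 3) ^ 6)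
      < (k - 1) * (0.9 * V ^ 2) / (2 * w ^ 3) := by
        rw [hV, div_lt_div_iff₀ (by positivity) (by positivity)]
        have h8 : ((k : ℝ) - 1) * (0.9 * (4 * w ^ 2 / (3 * ℓ ^ 9)) ^ 2) * (3 * (ℓ ^ 3) ^ 6)
            = 4.8 * ((k - 1) * w ^ 4) := by
          field_simp
          ring
        rw [h8]
        have : 0 < ((k : ℝ) - 1) * w ^ 4 := by positivity
        linarith [show ((k : ℝ) - 1) * w * (2 * w ^ 3) = 2 * ((k - 1) * w ^ 4) by ring]
    _ ≤ _ := by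
        rw [hw]
        gcongr

lemma tendsto_cast_mul_atTop {k : ℕ} (hk : 0 < k) :
    Tendsto (fun r : ℕ => ((k * r : ℕ) : ℝ)) atTop atTop :=
  tendsto_natCast_atTop_atTop.comp (tendsto_id.const_mul_atTop' hk)

lemma eventually_log_pow_le (C : ℝ) :
    ∀ᶠ x : ℝ in atTop, C * Real.log x ^ 3 ≤ x ^ ((1 : ℝ) / 3) := by
  have h := (isLittleO_log_rpow_rpow_atTop 3 (by norm_num : (0 : ℝ) < 1 / 3)).const_mul_left C
  filter_upwards [h.bound one_pos, eventually_ge_atTop 0] with x hx hx0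
  have h1 : ‖x ^ ((1 : ℝ) / 3)‖ = x ^ ((1 : ℝ) / 3) :=
    Real.norm_of_nonneg (Real.rpow_nonneg hx0 _)
  rw [h1, one_mul] at hx
  refine (le_abs_self _).trans ?_
  rw [← Real.norm_eq_abs]
  exact_mod_cast hx

end Asymptotics

/-- the probability that a uniform `{0,k}`-mapping has
`T ≥ (E_n(T))^a` is exponentially small, so the expected number of samples needed to
find such a mapping is exponentially large. -/
theorem stmt_17 (k : ℕ) (hk : 2 ≤ k) (a : ℕ → ℝ) (ha : ∀ r, 0 < a r)
    (hao : Tendsto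
      (fun r : ℕ => (a r)⁻¹ * (Real.log ((k * r : ℕ) : ℝ)) ^ (-(1 : ℝ) / 3))
      atTop (nhds 0))
    (ξ P : ℕ → ℝ)
    (hξ : ∀ r, ξ r = (zkExp (k * r) k (fun g => (Tmap g : ℝ))) ^ (a r))
    (hP : ∀ r, P r = zkProb (k * r) k (fun f => ξ r ≤ (Tmap f : ℝ))) :
    ∀ᶠ r : ℕ in atTop,
      P r < Real.exp (-(((k : ℝ) - 1) * ((k * r : ℕ) : ℝ) ^ ((1 : ℝ) / 3) /
        (3 * (Real.log ((k * r : ℕ) : ℝ)) ^ 6))) ∧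
      Real.exp (((k : ℝ) - 1) * ((k * r : ℕ) : ℝ) ^ ((1 : ℝ) / 3) /
        (3 * (Real.log ((k * r : ℕ) : ℝ)) ^ 6)) * P r < 1 ∧
      Real.exp (((k : ℝ) - 1) * ((k * r : ℕ) : ℝ) ^ ((1 : ℝ) / 3) /
        (4 * (Real.log ((k * r : ℕ) : ℝ)) ^ 6)) * P r ≤
        Real.exp (-(((k : ℝ) - 1) * ((k * r : ℕ) : ℝ) ^ ((1 : ℝ) / 3) /
          (12 * (Real.log ((k * r : ℕ) : ℝ)) ^ 6))) := by
  have htop := tendsto_cast_mul_atTop (by omega : 0 < k)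
  have hsmall : (0 : ℝ) < 1 / (2880 * k) := by positivity
  have hmain : ∀ᶠ r : ℕ in atTop,
      P r < Real.exp (-(((k : ℝ) - 1) * ((k * r : ℕ) : ℝ) ^ ((1 : ℝ) / 3) /
        (3 * (Real.log ((k * r : ℕ) : ℝ)) ^ 6))) := by
    filter_upwards [htop.eventually (eventually_log_pow_le (900 * k)),
      htop.eventually (eventually_ge_atTop (Real.exp 1)),
      hao.eventually (eventually_le_nhds hsmall)] with r h1 h2 h3
    set x : ℝ := ((k * r : ℕ) : ℝ) with hx
    have hx0 : 0 < x := (Real.exp_pos 1).trans_le h2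
    have hL : 1 ≤ Real.log x := (Real.le_log_iff_exp_le hx0).2 h2
    have hℓ : (Real.log x ^ ((1 : ℝ) / 3)) ^ 3 = Real.log x := by
      rw [← Real.rpow_natCast, ← Real.rpow_mul (by linarith)]
      norm_num
    have hw : (x ^ ((1 : ℝ) / 3)) ^ 3 = x := by
      rw [← Real.rpow_natCast, ← Real.rpow_mul hx0.le]
      norm_num
    have hℓpos : 0 < Real.log x ^ ((1 : ℝ) / 3) := Real.rpow_pos_of_pos (by linarith) _
    have hneg : Real.log x ^ (-(1 : ℝ) / 3) = (Real.log x ^ ((1 : ℝ) / 3))⁻¹ := by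
      rw [neg_div, Real.rpow_neg (by linarith)]
    have hlt := zkProb_lt (r := r) hk (a := a r) (ℓ := Real.log x ^ ((1 : ℝ) / 3))
      (w := x ^ ((1 : ℝ) / 3)) (Real.one_le_rpow hL (by norm_num)) hℓ.symm hw
      (by rw [show (9 : ℕ) = 3 * 3 by norm_num, pow_mul, hℓ]; exact h1)
      (by
        rw [hneg, ← mul_inv, ← one_div] at h3
        exact (one_div_le_one_div (mul_pos (ha r) hℓpos) (by positivity)).1 h3)
    rw [hℓ, ← hξ r, ← hP r] at hlt
    exact hlt
  filter_upwards [hmain] with r hr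
  refine ⟨hr, ?_, ?_⟩
  · calc _ < Real.exp (((k : ℝ) - 1) * ((k * r : ℕ) : ℝ) ^ ((1 : ℝ) / 3) /
          (3 * (Real.log ((k * r : ℕ) : ℝ)) ^ 6)) * _ :=
        mul_lt_mul_of_pos_left hr (Real.exp_pos _)
      _ = 1 := by rw [← Real.exp_add, add_neg_cancel, Real.exp_zero]
  · refine (mul_le_mul_of_nonneg_left hr.le (Real.exp_pos _).le).trans_eq ?_
    rw [← Real.exp_add]
    congr 1
    ring
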